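/- Let n ≥ 3 and let A = A_n(α,β,γ). Then the characteristic polynomial of A equals (X − λ₁)·(X − λ₂)^{n−1}·(X − λ₃)^{N−n}, where λ₁ = α + 2(n−2)β + ((n−2)(n−3)/2)γ, λ₂ = α + (n−4)β − (n−3)γ, and λ₃ = α − 2β + γ. In particular A has (at most) the three eigenvalues λ₁, λ₂, λ₃ with multiplicities 1, n−1, and N−n respectively, and det A = λ₁·λ₂^{n−1}·λ₃^{N−n}. -/

import Mathlib

open Polynomial

/-- Index type: unordered pairs of distinct elements of `Fin n`. -/
def Pairs (n : ℕ) : Type := {p : Sym2 (Fin n) // ¬ p.IsDiag}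

instance (n : ℕ) : Fintype (Pairs n) := Subtype.fintype _
instance (n : ℕ) : DecidableEq (Pairs n) := Subtype.instDecidableEq

/-- The `S_n`-invariant matrix `A_n(α,β,γ)`. -/
def An (n : ℕ) (α β γ : ℝ) : Matrix (Pairs n) (Pairs n) ℝ := fun p q =>
  if p = q then α else if ∃ x, x ∈ p.1 ∧ x ∈ q.1 then β else γ

namespace Matrix

variable {R ι : Type*} [CommRing R] [Fintype ι] [DecidableEq ι]

theorem charpoly_add_scalar (M : Matrix ι ι R) (μ : R) :
    (M + scalar ι μ).charpoly = M.charpoly.comp (X - C μ) := by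
  simpa [-scalar_apply, sub_eq_add_neg] using charpoly_sub_scalar M (-μ)

theorem charpoly_const_add_scalar [Nonempty ι] (a b : R) :
    (of (fun _ _ : ι => b) + scalar ι a).charpoly
      = (X - C a) ^ (Fintype.card ι - 1) * (X - C (a + Fintype.card ι * b)) := by
  have h : of (fun _ _ : ι => b) = vecMulVec (fun _ => b) (fun _ => 1) := by
    ext i j
    simp [vecMulVec_apply]
  have hcard : Fintype.card ι = Fintype.card ι - 1 + 1 :=
    (Nat.succ_pred_eq_of_pos Fintype.card_pos).symm
  rw [charpoly_add_scalar, h, charpoly_vecMulVec]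
  conv_lhs => rw [hcard, pow_succ]
  simp [dotProduct, smul_eq_C_mul]
  ring

end Matrix

namespace Pairs

variable {n : ℕ}

theorem card_eq (n : ℕ) : Fintype.card (Pairs n) = n.choose 2 :=
  Sym2.card_subtype_not_diag.trans (by rw [Fintype.card_fin])

theorem card_mem (p : Pairs n) : (Finset.univ.filter (· ∈ p.1)).card = 2 := by
  rw [← Sym2.card_toFinset_of_not_isDiag p.1 p.2]
  congr 1
  ext x
  simp

theorem card_mem_inter {p q : Pairs n} (hpq : p ≠ q) :
    (Finset.univ.filter fun x => x ∈ p.1 ∧ x ∈ q.1).card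
      = if ∃ x, x ∈ p.1 ∧ x ∈ q.1 then 1 else 0 := by
  split_ifs with h
  · obtain ⟨x, hx⟩ := h
    refine Finset.card_eq_one.2 ⟨x, Finset.eq_singleton_iff_unique_mem.2 ⟨by simpa using hx, ?_⟩⟩
    intro y hy
    simp only [Finset.mem_filter, Finset.mem_univ, true_and] at hy
    by_contra hxy
    exact hpq (Subtype.ext (((Sym2.mem_and_mem_iff hxy).1 ⟨hy.1, hx.1⟩).trans
      ((Sym2.mem_and_mem_iff hxy).1 ⟨hy.2, hx.2⟩).symm))
  · simpa using h

theorem card_containing (u : Fin n) :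
    (Finset.univ.filter fun p : Pairs n => u ∈ p.1).card = n - 1 := by
  have h := (⊤ : SimpleGraph (Fin n)).card_incidenceFinset_eq_degree u
  rw [SimpleGraph.complete_graph_degree, Fintype.card_fin] at h
  rw [← h]
  refine Finset.card_bij (fun p _ => p.1) ?_ (fun _ _ _ _ => Subtype.ext) ?_
  · intro p hp
    simpa [SimpleGraph.incidenceSet, p.2] using hp
  · intro e he
    have he' : ¬ e.IsDiag ∧ u ∈ e := by simpa [SimpleGraph.incidenceSet] using he
    exact ⟨⟨e, he'.1⟩, Finset.mem_filter.2 ⟨Finset.mem_univ _, he'.2⟩, rfl⟩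

theorem card_containing_both {u v : Fin n} (huv : u ≠ v) :
    (Finset.univ.filter fun p : Pairs n => u ∈ p.1 ∧ v ∈ p.1).card = 1 := by
  obtain ⟨w, hw⟩ : ∃ w : Pairs n, w.1 = s(u, v) := ⟨⟨s(u, v), by simpa using huv⟩, rfl⟩
  refine Finset.card_eq_one.2 ⟨w, Finset.ext fun p => ?_⟩
  rw [Finset.mem_filter, Finset.mem_singleton, Sym2.mem_and_mem_iff huv, ← hw]
  exact (and_iff_right (Finset.mem_univ p)).trans Subtype.ext_iff.symm

/-- The affine function `b * B + c` (applied entrywise) of the incidence matrix `B` between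
points and pairs. -/
def inc (n : ℕ) (b c : ℝ) : Matrix (Fin n) (Pairs n) ℝ :=
  fun v p => b * (if v ∈ p.1 then 1 else 0) + c

theorem An_eq (n : ℕ) (α β γ : ℝ) :
    An n α β γ = (inc n 1 0).transpose * inc n (β - γ) (γ / 2)
      + Matrix.scalar (Pairs n) (α - 2 * β + γ) := by
  ext p q
  have key : ((inc n 1 0).transpose * inc n (β - γ) (γ / 2)) p q
      = (β - γ) * (Finset.univ.filter fun x => x ∈ p.1 ∧ x ∈ q.1).card + γ := by
    have : ∀ x, (inc n 1 0).transpose p x * inc n (β - γ) (γ / 2) x q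
        = (β - γ) * (if x ∈ p.1 ∧ x ∈ q.1 then 1 else 0)
          + γ / 2 * (if x ∈ p.1 then 1 else 0) := by
      intro x
      simp only [inc, Matrix.transpose_apply]
      split_ifs <;> first | tauto | ring
    rw [Matrix.mul_apply, Finset.sum_congr rfl fun x _ => this x, Finset.sum_add_distrib,
      ← Finset.mul_sum, ← Finset.mul_sum, Finset.sum_boole, Finset.sum_boole, card_mem]
    push_cast
    ring
  rw [Matrix.add_apply, key, Matrix.scalar_apply, Matrix.diagonal_apply, An]
  by_cases hpq : p = q
  · subst hpq
    simp only [and_self, card_mem, if_true]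
    push_cast
    ring
  · rw [card_mem_inter hpq, if_neg hpq, if_neg hpq]
    split_ifs <;> push_cast <;> ring

theorem inc_mul_inc_transpose (hn : 1 ≤ n) (b c : ℝ) :
    inc n b c * (inc n 1 0).transpose
      = Matrix.of (fun _ _ => b + c * ((n : ℝ) - 1))
        + Matrix.scalar (Fin n) (b * ((n : ℝ) - 2)) := by
  ext u v
  have key : ∀ p, inc n b c u p * (inc n 1 0).transpose p v
      = b * (if u ∈ p.1 ∧ v ∈ p.1 then 1 else 0) + c * (if v ∈ p.1 then 1 else 0) := by
    intro p
    simp only [inc, Matrix.transpose_apply]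
    split_ifs <;> first | tauto | ring
  rw [Matrix.mul_apply, Finset.sum_congr rfl fun p _ => key p, Finset.sum_add_distrib,
    ← Finset.mul_sum, ← Finset.mul_sum, Finset.sum_boole, Finset.sum_boole, card_containing,
    Matrix.add_apply, Matrix.of_apply, Matrix.scalar_apply, Matrix.diagonal_apply]
  by_cases huv : u = v
  · subst huv
    simp only [and_self, card_containing, if_true]
    push_cast [hn]
    ring
  · rw [card_containing_both huv, if_neg huv]
    push_cast [hn]
    ring

end Pairs

theorem Nat.self_le_choose_two {n : ℕ} (hn : 3 ≤ n) : n ≤ n.choose 2 := by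
  rw [Nat.choose_two_right, Nat.le_div_iff_mul_le two_pos]
  exact Nat.mul_le_mul_left n (by omega)

/-- The characteristic polynomial of `A_n(α,β,γ)` is
`(X − λ₁)(X − λ₂)^{n−1}(X − λ₃)^{N−n}`, and `det A_n = λ₁ λ₂^{n−1} λ₃^{N−n}`. -/
theorem An_charpoly (n : ℕ) (hn : 3 ≤ n) (α β γ : ℝ)
    (lam1 lam2 lam3 : ℝ)
    (h1 : lam1 = α + 2 * ((n : ℝ) - 2) * β + (((n : ℝ) - 2) * ((n : ℝ) - 3) / 2) * γ)
    (h2 : lam2 = α + ((n : ℝ) - 4) * β - ((n : ℝ) - 3) * γ)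
    (h3 : lam3 = α - 2 * β + γ) :
    (An n α β γ).charpoly
      = (X - C lam1) * (X - C lam2) ^ (n - 1) * (X - C lam3) ^ (n.choose 2 - n) ∧
    (An n α β γ).det = lam1 * lam2 ^ (n - 1) * lam3 ^ (n.choose 2 - n) := by
  have hle : n ≤ n.choose 2 := Nat.self_le_choose_two hn
  have : Nonempty (Fin n) := ⟨⟨0, by omega⟩⟩
  have hchar : (An n α β γ).charpoly
      = (X - C lam1) * (X - C lam2) ^ (n - 1) * (X - C lam3) ^ (n.choose 2 - n) := by
    have e1 : lam3 + ((β - γ) * ((n : ℝ) - 2)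
        + n * ((β - γ) + γ / 2 * ((n : ℝ) - 1))) = lam1 := by
      rw [h1, h3]; ring
    have e2 : lam3 + (β - γ) * ((n : ℝ) - 2) = lam2 := by
      rw [h2, h3]; ring
    rw [Pairs.An_eq, Matrix.charpoly_add_scalar,
      Matrix.charpoly_mul_comm_of_le _ _ (by rwa [Fintype.card_fin, Pairs.card_eq]),
      Pairs.inc_mul_inc_transpose (by omega), Matrix.charpoly_const_add_scalar,
      Fintype.card_fin, Pairs.card_eq, ← h3, ← e1, ← e2]
    simp only [mul_comp, pow_comp, sub_comp, X_comp, C_comp, sub_sub, ← C_add]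
    ring
  refine ⟨hchar, ?_⟩
  have hsplits : (An n α β γ).charpoly.Splits := by
    rw [hchar]
    exact ((Splits.X_sub_C _).mul ((Splits.X_sub_C _).pow _)).mul ((Splits.X_sub_C _).pow _)
  rw [Matrix.det_eq_prod_roots_charpoly_of_splits hsplits, hchar, roots_mul, roots_mul]
  · simp [Multiset.prod_nsmul, mul_assoc]
  all_goals simp [X_sub_C_ne_zero]
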